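/- arXiv:1205.6534 — 2 statements merged into one kernel-verified Lean document; each statement's English description precedes it below -/
import Mathlib

section
/- Let (M, ρ) be a nonempty compact metric space with a Borel probability measure μ, and let b, r_0, m > 0 satisfy μ(B(p,r)) > b·r^m for every p ∈ M and every r ∈ (0, r_0), where B(p,r) is the open ball of radius r. Let d ≥ 1 and e_0, …, e_d : M → ℝ be continuous functions forming an orthonormal family in L²(μ) and satisfying ∑_{i=0}^d e_i(p)² = d + 1 for every p ∈ M; let σ be the rotation-invariant probability measure on the unit sphere S^d of ℝ^{d+1} and u_x = ∑_i x_i e_i for x ∈ S^d. Let κ > 0 be such that log κ ≥ 2, 1/κ < r_0, and every function u_x, x ∈ S^d, is Lipschitz with constant κ. Then ∫_{S^d} sup_{p∈M} |u_x(p)| dσ(x) < max(1, b^{−1/2}) · e^m · √((log κ + 1)/e) + 1. -/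
open MeasureTheory Real

theorem Real.log_three_halves_le : log (3 / 2) ≤ 0.41 := by
  have h1 : log (9 / 8) ≤ 9 / 8 - 1 := log_le_sub_one_of_pos (by norm_num)
  have h2 : 2 * log (3 / 2) = log 2 + log (9 / 8) := by
    rw [← log_mul (by norm_num) (by norm_num), ← Nat.cast_ofNat (R := ℝ), ← log_pow]
    norm_num
  linarith [log_two_lt_d9]

/-- A Stirling-type upper bound for `Real.Gamma` on `[3/2, 5/2]`. -/
theorem Real.log_Gamma_lt_of_mem_Icc {z : ℝ} (hz : z ∈ Set.Icc (3 / 2 : ℝ) (5 / 2)) :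
    log (Gamma z) < log (√π) + 1 / 2 + (z - 1 / 2) * log z - z := by
  obtain ⟨t, rfl⟩ : ∃ t, z = 3 / 2 + t := ⟨z - 3 / 2, by ring⟩
  have ht0 : 0 ≤ t := by linarith [hz.1]
  have ht1 : t ≤ 1 := by linarith [hz.2]
  have hπ : 0 < √π := sqrt_pos.2 pi_pos
  have h32 : log (Gamma (3 / 2)) = log (√π) - log 2 := by
    rw [show (3 / 2 : ℝ) = 1 / 2 + 1 by norm_num, Gamma_add_one (by norm_num), Gamma_one_half_eq,
      ← log_div hπ.ne' (by norm_num)]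
    congr 1
    ring
  have h52 : log (Gamma (5 / 2)) = log (3 / 2) + log (Gamma (3 / 2)) := by
    rw [show (5 / 2 : ℝ) = 3 / 2 + 1 by norm_num, Gamma_add_one (by norm_num),
      log_mul (by norm_num) (Gamma_pos_of_pos (by norm_num)).ne']
  have hconv := convexOn_log_Gamma.2 (x := 3 / 2) (y := 5 / 2) (by norm_num) (by norm_num)
    (sub_nonneg.2 ht1) ht0 (by ring)
  simp only [Function.comp, smul_eq_mul] at hconv
  rw [show (1 - t) * (3 / 2) + t * (5 / 2) = 3 / 2 + t by ring, h52, h32] at hconv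
  have hlog : log 2 + (1 - 2 / (3 / 2 + t)) ≤ log (3 / 2 + t) := by
    have := one_sub_inv_le_log_of_pos (x := (3 / 2 + t) / 2) (by positivity)
    rw [inv_div, log_div (by positivity) (by norm_num)] at this
    linarith
  have hmul := mul_le_mul_of_nonneg_left hlog (by linarith : 0 ≤ 1 + t)
  have hrat : 0 < (1 + t) * (0.6931 + (1 - 2 / (3 / 2 + t))) - 1 - t - t * 0.41 + 0.6931 := by
    have : (1 + t) * (0.6931 + (1 - 2 / (3 / 2 + t))) - 1 - t - t * 0.41 + 0.6931 =
        ((1 + t) * (0.6931 * (3 / 2 + t) - 2) + (3 / 2 + t) * (0.6931 - t * 0.41)) /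
          (3 / 2 + t) := by
      field_simp
      ring
    rw [this]
    apply div_pos _ (by positivity)
    nlinarith [sq_nonneg (t - 0.4)]
  nlinarith [log_two_gt_d9, log_three_halves_le]

/-- A Stirling-type upper bound for `Real.Gamma`. -/
theorem Real.log_Gamma_lt {z : ℝ} (hz : 3 / 2 ≤ z) :
    log (Gamma z) < log (√π) + 1 / 2 + (z - 1 / 2) * log z - z := by
  obtain ⟨n, hn⟩ := exists_nat_ge (z - 5 / 2)
  induction n generalizing z with
  | zero => exact log_Gamma_lt_of_mem_Icc ⟨hz, by simpa using hn⟩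
  | succ n ih =>
    by_cases h : z ≤ 5 / 2
    · exact log_Gamma_lt_of_mem_Icc ⟨hz, h⟩
    obtain ⟨w, rfl⟩ : ∃ w, z = w + 1 := ⟨z - 1, by ring⟩
    have hw0 : 0 < w := by linarith
    have hw := @ih w (by linarith) (by push_cast at hn; linarith)
    rw [Gamma_add_one hw0.ne', log_mul hw0.ne' (Gamma_pos_of_pos hw0).ne']
    have hl := le_log_one_add_of_nonneg (x := w⁻¹) (by positivity)
    rw [show 1 + w⁻¹ = (w + 1) / w by field_simp, log_div (by positivity) hw0.ne',
      show 2 * w⁻¹ / (w⁻¹ + 2) = 1 / (w + 1 / 2) by field_simp; ring,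
      div_le_iff₀ (by positivity)] at hl
    linarith

theorem Real.Gamma_lt_rpow {a : ℝ} (ha : 2 ≤ a) :
    2 ^ (a / 2) * Gamma ((a + 1) / 2) / √π < ((a + 1) / exp 1) ^ (a / 2) := by
  have hπ : 0 < √π := sqrt_pos.2 pi_pos
  have hG : 0 < Gamma ((a + 1) / 2) := Gamma_pos_of_pos (by linarith)
  rw [← log_lt_log_iff (by positivity) (by positivity), log_div (by positivity) hπ.ne',
    log_mul (by positivity) hG.ne', log_rpow (by norm_num), log_rpow (by positivity),
    log_div (by positivity) (by positivity), log_exp]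
  have h := log_Gamma_lt (z := (a + 1) / 2) (by linarith)
  rw [log_div (by positivity) (by norm_num)] at h
  linarith

open ProbabilityTheory in
theorem ProbabilityTheory.integral_abs_rpow_gaussianReal {a : ℝ} (ha : 0 ≤ a) :
    ∫ t, |t| ^ a ∂(gaussianReal 0 1) = 2 ^ (a / 2) * Gamma ((a + 1) / 2) / √π := by
  rw [integral_gaussianReal_eq_integral_smul one_ne_zero]
  simp only [gaussianPDFReal_def, smul_eq_mul]
  have h := integral_rpow_mul_exp_neg_mul_rpow (p := 2) (q := a) (b := 1 / 2) (by norm_num)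
    (by linarith) (by norm_num)
  have habs := integral_comp_abs
    (f := fun x ↦ (√(2 * π))⁻¹ * (x ^ a * exp (-(1 / 2) * x ^ (2 : ℝ))))
  convert habs using 1
  · refine integral_congr_ae (.of_forall fun x ↦ ?_)
    have : |x| ^ (2 : ℝ) = x ^ 2 := by rw [rpow_two, sq_abs]
    simp only [this]
    norm_num
    ring_nf
  · have : (1 / 2 : ℝ) ^ (-(a + 1) / 2) = 2 ^ (a / 2) * √2 := by
      rw [one_div, inv_rpow (by norm_num), ← rpow_neg (by norm_num), sqrt_eq_rpow,
        ← rpow_add (by norm_num)]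
      congr 1
      ring
    rw [integral_const_mul, h, this, sqrt_mul (by norm_num)]
    field_simp

/-- **Lyapunov's inequality** for a nonnegative function on a probability space. -/
theorem MeasureTheory.rpow_integral_le_integral_rpow {Ω : Type*} [MeasurableSpace Ω]
    {P : Measure Ω} [IsProbabilityMeasure P] {f : Ω → ℝ} {a : ℝ} (ha : 1 ≤ a)
    (hf0 : ∀ ω, 0 ≤ f ω) (hf : Integrable f P) (hfa : Integrable (fun ω ↦ f ω ^ a) P) :
    (∫ ω, f ω ∂P) ^ a ≤ ∫ ω, f ω ^ a ∂P :=
  (convexOn_rpow ha).map_integral_le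
    (continuous_id.rpow_const fun _ ↦ .inr (by linarith)).continuousOn isClosed_Ici
    (.of_forall hf0) hf hfa

section Sphere

open ProbabilityTheory Module
open scoped RealInnerProductSpace

variable {E : Type*} [NormedAddCommGroup E] [InnerProductSpace ℝ E] [FiniteDimensional ℝ E]
  [MeasurableSpace E] [BorelSpace E]

theorem ProbabilityTheory.map_inner_stdGaussian {x : E} (hx : ‖x‖ = 1) :
    (stdGaussian E).map (fun w ↦ ⟪x, w⟫) = gaussianReal 0 1 := by
  have h := IsGaussian.map_eq_gaussianReal (μ := stdGaussian E) (innerSL ℝ x)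
  rw [integral_strongDual_stdGaussian, variance_dual_stdGaussian, innerSL_apply_norm, hx] at h
  simpa using h

theorem ProbabilityTheory.integral_norm_sq_stdGaussian :
    ∫ w, ‖w‖ ^ 2 ∂(stdGaussian E) = finrank ℝ E := by
  have hsq (i) : ∫ w, ⟪stdOrthonormalBasis ℝ E i, w⟫ ^ 2 ∂(stdGaussian E) = 1 := by
    rw [← integral_map (φ := fun w ↦ ⟪stdOrthonormalBasis ℝ E i, w⟫) (f := fun t : ℝ ↦ t ^ 2)
      (by fun_prop) (by fun_prop), map_inner_stdGaussian (by simp)]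
    have := variance_eq_integral (μ := gaussianReal 0 1) (X := id) (by fun_prop)
    simpa using this.symm
  have hint (i) : Integrable (fun w ↦ ⟪stdOrthonormalBasis ℝ E i, w⟫ ^ 2) (stdGaussian E) :=
    not_imp_comm.1 integral_undef (by simp [hsq])
  simp_rw [← (stdOrthonormalBasis ℝ E).sum_sq_inner_right]
  rw [integral_finsetSum _ fun i _ ↦ hint i]
  simp [hsq]

theorem ProbabilityTheory.integrable_norm_rpow_stdGaussian {a : ℝ} (ha : 0 < a) :
    Integrable (fun w ↦ ‖w‖ ^ a) (stdGaussian E) := by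
  have h := (IsGaussian.memLp_id (stdGaussian E) (.ofReal a) (by simp)).integrable_norm_rpow
    (by simpa using ha) (by simp)
  simpa [ENNReal.toReal_ofReal ha.le] using h

theorem ProbabilityTheory.finrank_rpow_le_integral_norm_rpow_stdGaussian {a : ℝ} (ha : 2 ≤ a) :
    (finrank ℝ E : ℝ) ^ (a / 2) ≤ ∫ w, ‖w‖ ^ a ∂(stdGaussian E) := by
  have hpow (w : E) : (‖w‖ ^ 2) ^ (a / 2) = ‖w‖ ^ a := by
    rw [← rpow_natCast, ← rpow_mul (norm_nonneg w)]
    congr 1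
    push_cast
    ring
  have h := rpow_integral_le_integral_rpow (P := stdGaussian E) (f := fun w ↦ ‖w‖ ^ 2)
    (a := a / 2) (by linarith) (fun _ ↦ by positivity)
    (by simpa using integrable_norm_rpow_stdGaussian (E := E) two_pos)
    (by simpa only [hpow] using integrable_norm_rpow_stdGaussian (E := E) (by linarith : 0 < a))
  simpa only [hpow, integral_norm_sq_stdGaussian] using h

theorem integral_abs_inner_rpow_eq_of_norm_eq {F : Type*} [NormedAddCommGroup F]
    [InnerProductSpace ℝ F] [MeasurableSpace F] [BorelSpace F] {σ : Measure F}
    (hσ : ∀ g : F ≃ₗᵢ[ℝ] F, σ.map g = σ) {a : ℝ} (ha : 0 ≤ a) {v w : F} (h : ‖v‖ = ‖w‖) :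
    ∫ x, |⟪x, v⟫| ^ a ∂σ = ∫ x, |⟪x, w⟫| ^ a ∂σ := by
  let g := (ℝ ∙ (v - w))ᗮ.reflection
  have hg : g v = w := Submodule.reflection_sub h
  have hc : Continuous fun x ↦ |⟪x, w⟫| ^ a :=
    (by fun_prop : Continuous fun x ↦ |⟪x, w⟫|).rpow_const fun _ ↦ .inr ha
  rw [← hσ g, integral_map g.continuous.aemeasurable hc.aestronglyMeasurable, hσ g]
  simp_rw [← hg, g.inner_map_map]

variable {σ : Measure E} [IsProbabilityMeasure σ]

/-- The `a`-th absolute moment of a coordinate on the sphere of radius `√(dim E)` is at most the one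
of a standard normal variable. -/
theorem integral_abs_inner_rpow_le_gaussianReal (hσ : ∀ g : E ≃ₗᵢ[ℝ] E, σ.map g = σ)
    (hσ1 : ∀ᵐ x ∂σ, ‖x‖ = 1) {a : ℝ} (ha : 2 ≤ a) (hE : 0 < finrank ℝ E) {v : E}
    (hv : ‖v‖ ^ 2 = finrank ℝ E) :
    ∫ x, |⟪x, v⟫| ^ a ∂σ ≤ ∫ t, |t| ^ a ∂(gaussianReal 0 1) := by
  have ha0 : 0 ≤ a := by linarith
  set J : E → ℝ := fun w ↦ ∫ x, |⟪x, w⟫| ^ a ∂σ with hJ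
  have hsmul (c : ℝ) (w : E) : J (c • w) = |c| ^ a * J w := by
    simp only [hJ, inner_smul_right, abs_mul, mul_rpow (abs_nonneg _) (abs_nonneg _),
      integral_const_mul]
  have hJ0 (w : E) : 0 ≤ J w := integral_nonneg fun _ ↦ by positivity
  have hhom (w : E) : ‖v‖ ^ a * J w = ‖w‖ ^ a * J v := by
    rw [← abs_norm v, ← abs_norm w, ← hsmul, ← hsmul]
    exact integral_abs_inner_rpow_eq_of_norm_eq hσ ha0 (by simp [norm_smul, mul_comm])
  have hcont : Continuous fun q : E × E ↦ |⟪q.1, q.2⟫| ^ a :=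
    (by fun_prop : Continuous fun q : E × E ↦ |⟪q.1, q.2⟫|).rpow_const fun _ ↦ .inr ha0
  have hint : Integrable (fun q : E × E ↦ |⟪q.1, q.2⟫| ^ a) (σ.prod (stdGaussian E)) := by
    refine ((integrable_norm_rpow_stdGaussian (by linarith : 0 < a)).comp_snd σ).mono'
      hcont.aestronglyMeasurable ?_
    filter_upwards [Measure.quasiMeasurePreserving_fst.ae hσ1] with q hq
    rw [norm_of_nonneg (by positivity)]
    gcongr
    simpa [hq] using abs_real_inner_le_norm q.1 q.2
  have hswap : ∫ w, J w ∂(stdGaussian E) = ∫ t, |t| ^ a ∂(gaussianReal 0 1) := by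
    rw [hJ, ← integral_integral_swap hint]
    have : ∀ᵐ x ∂σ, ∫ w, |⟪x, w⟫| ^ a ∂(stdGaussian E) = ∫ t, |t| ^ a ∂(gaussianReal 0 1) := by
      filter_upwards [hσ1] with x hx
      rw [← map_inner_stdGaussian hx, integral_map (by fun_prop)
        (continuous_abs.rpow_const fun _ ↦ .inr ha0).aestronglyMeasurable]
    rw [integral_congr_ae this]
    simp
  have hva : ‖v‖ ^ a = (finrank ℝ E : ℝ) ^ (a / 2) := by
    rw [← hv, ← rpow_natCast, ← rpow_mul (norm_nonneg v)]
    congr 1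
    push_cast
    ring
  have hva0 : 0 < ‖v‖ ^ a := by
    rw [hva]
    positivity
  refine le_of_mul_le_mul_left ?_ hva0
  calc ‖v‖ ^ a * J v ≤ (∫ w, ‖w‖ ^ a ∂(stdGaussian E)) * J v := by
        rw [hva]
        exact mul_le_mul_of_nonneg_right (finrank_rpow_le_integral_norm_rpow_stdGaussian ha) (hJ0 v)
    _ = ‖v‖ ^ a * ∫ t, |t| ^ a ∂(gaussianReal 0 1) := by
        rw [← hswap, ← integral_mul_const, ← integral_const_mul]
        simp_rw [hhom]

end Sphere

/-- A Chebyshev-type bound on the sup norm of a Lipschitz function. -/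
theorem ContinuousMap.mul_rpow_norm_sub_one_le_integral {M : Type*} [PseudoMetricSpace M]
    [CompactSpace M] [Nonempty M] [MeasurableSpace M] [BorelSpace M] {μ : Measure M}
    [IsFiniteMeasure μ] {c κ a : ℝ} (hκ : 0 < κ) (ha : 0 ≤ a)
    (hball : ∀ p, c ≤ μ.real (Metric.ball p (1 / κ))) (f : C(M, ℝ))
    (hf : ∀ p q, |f p - f q| ≤ κ * dist p q) :
    c * max (‖f‖ - 1) 0 ^ a ≤ ∫ p, |f p| ^ a ∂μ := by
  obtain ⟨p, hp⟩ : ∃ p, ‖f‖ = |f p| := by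
    obtain ⟨p, -, hp⟩ := isCompact_univ.exists_isMaxOn Set.univ_nonempty
      (f.continuous.norm.continuousOn)
    exact ⟨p, le_antisymm ((f.norm_le (abs_nonneg _)).2 fun q ↦ hp (Set.mem_univ q))
      (f.norm_coe_le_norm p)⟩
  have hsub : Metric.ball p (1 / κ) ⊆ {q | max (‖f‖ - 1) 0 ^ a ≤ |f q| ^ a} := fun q hq ↦ by
    refine rpow_le_rpow (le_max_right _ _) (max_le ?_ (abs_nonneg _)) ha
    have h1 : κ * dist p q ≤ 1 := by
      rw [Metric.mem_ball', lt_div_iff₀ hκ] at hq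
      linarith
    rw [hp]
    linarith [hf p q, abs_sub_abs_le_abs_sub (f p) (f q)]
  have hint : Integrable (fun q ↦ |f q| ^ a) μ := by
    have hc : Continuous fun q ↦ |f q| ^ a := f.continuous.abs.rpow_const fun _ ↦ .inr ha
    exact hc.integrable_of_hasCompactSupport (.of_compactSpace _)
  calc c * max (‖f‖ - 1) 0 ^ a
      ≤ max (‖f‖ - 1) 0 ^ a * μ.real {q | max (‖f‖ - 1) 0 ^ a ≤ |f q| ^ a} := by
        rw [mul_comm]
        gcongr
        exact (hball p).trans (measureReal_mono hsub)
    _ ≤ ∫ p, |f p| ^ a ∂μ :=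
        mul_meas_ge_le_integral_of_nonneg (.of_forall fun _ ↦ by positivity) hint _

theorem Continuous.integrable_of_ae_norm_eq {E F : Type*} [NormedAddCommGroup E] [ProperSpace E]
    [MeasurableSpace E] [BorelSpace E] [NormedAddCommGroup F] {σ : Measure E}
    [IsFiniteMeasure σ] {r : ℝ} (hσ : ∀ᵐ x ∂σ, ‖x‖ = r) {f : E → F} (hf : Continuous f) :
    Integrable f σ := by
  have h := hf.continuousOn.integrableOn_compact (μ := σ) (isCompact_sphere (0 : E) r)
  rwa [IntegrableOn, Measure.restrict_eq_self_of_ae_mem (by simpa using hσ)] at h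

theorem one_le_mul_max_rpow {b κ m : ℝ} (hb : 0 < b) (hκ : 0 < κ) (hκ2 : 2 ≤ log κ) :
    1 ≤ b * (1 / κ) ^ m * (max 1 (b ^ (-(1 : ℝ) / 2)) * exp m) ^ log κ := by
  have hexp : (1 / κ) ^ m * exp m ^ log κ = 1 := by
    rw [← exp_mul, one_div, inv_rpow hκ.le, rpow_def_of_pos hκ, mul_comm m]
    exact inv_mul_cancel₀ (exp_pos _).ne'
  have hmax : b⁻¹ ≤ max 1 (b ^ (-(1 : ℝ) / 2)) ^ log κ := by
    calc b⁻¹ = (b ^ (-(1 : ℝ) / 2)) ^ (2 : ℝ) := by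
          rw [← rpow_mul hb.le, ← rpow_neg_one]
          norm_num
      _ ≤ max 1 (b ^ (-(1 : ℝ) / 2)) ^ (2 : ℝ) := by
          gcongr
          exact le_max_right _ _
      _ ≤ _ := rpow_le_rpow_of_exponent_le (le_max_left _ _) hκ2
  calc 1 = b * b⁻¹ := (mul_inv_cancel₀ hb.ne').symm
    _ ≤ b * max 1 (b ^ (-(1 : ℝ) / 2)) ^ log κ := by gcongr
    _ = b * max 1 (b ^ (-(1 : ℝ) / 2)) ^ log κ * ((1 / κ) ^ m * exp m ^ log κ) := by
        rw [hexp, mul_one]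
    _ = _ := by
        rw [mul_rpow (by positivity) (exp_pos m).le]
        ring


theorem stmt_7
    {M : Type*} [MetricSpace M] [CompactSpace M] [Nonempty M]
    [MeasurableSpace M] [BorelSpace M]
    (μ : Measure M) [IsProbabilityMeasure μ]
    (b r₀ m : ℝ) (hb : 0 < b) (hr₀ : 0 < r₀) (hm : 0 < m)
    (hball : ∀ p : M, ∀ r : ℝ, 0 < r → r < r₀ →
      ENNReal.ofReal (b * r ^ m) < μ (Metric.ball p r))
    (d : ℕ) (hd : 1 ≤ d)
    (e : Fin (d + 1) → M → ℝ) (hcont : ∀ i, Continuous (e i))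
    (horth : ∀ i j, ∫ p, e i p * e j p ∂μ = if i = j then 1 else 0)
    (hdiag : ∀ p, ∑ i, (e i p) ^ 2 = (d : ℝ) + 1)
    (σ : Measure (EuclideanSpace ℝ (Fin (d + 1)))) [IsProbabilityMeasure σ]
    (hσsph : σ (Metric.sphere (0 : EuclideanSpace ℝ (Fin (d + 1))) 1) = 1)
    (hσinv : ∀ g : EuclideanSpace ℝ (Fin (d + 1)) ≃ₗᵢ[ℝ] EuclideanSpace ℝ (Fin (d + 1)),
      σ.map g = σ)
    (κ : ℝ) (hκpos : 0 < κ) (hκlog : 2 ≤ Real.log κ) (hκr : 1 / κ < r₀)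
    (hLip : ∀ x ∈ Metric.sphere (0 : EuclideanSpace ℝ (Fin (d + 1))) 1,
      ∀ p q : M, |(∑ i, x i * e i p) - ∑ i, x i * e i q| ≤ κ * dist p q) :
    ∫ x, (⨆ p : M, |∑ i, x i * e i p|) ∂σ
      < max 1 (b ^ (-(1 : ℝ) / 2)) * Real.exp m *
          Real.sqrt ((Real.log κ + 1) / Real.exp 1) + 1 := by
  have hσ1 : ∀ᵐ x ∂σ, ‖x‖ = 1 := by
    filter_upwards [(mem_ae_iff_prob_eq_one Metric.isClosed_sphere.measurableSet).2 hσsph] with x hx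
    simpa using hx
  have : SecondCountableTopology M := EMetric.secondCountable_of_sigmaCompact M
  set a := log κ
  have ha0 : 0 ≤ a := by linarith
  set K := max 1 (b ^ (-(1 : ℝ) / 2)) * exp m
  set S := √((a + 1) / exp 1) with hS
  let U : EuclideanSpace ℝ (Fin (d + 1)) → C(M, ℝ) := fun x ↦ ∑ i, x i • ⟨e i, hcont i⟩
  have hU (x p) : U x p = ∑ i, x i * e i p := by simp [U]
  have hUc : Continuous U := by fun_prop
  let v : M → EuclideanSpace ℝ (Fin (d + 1)) := fun p ↦ WithLp.toLp 2 fun i ↦ e i p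
  have hUv (x p) : U x p = inner ℝ x (v p) := by
    simp [hU, v, PiLp.inner_apply, mul_comm]
  have hv (p) : ‖v p‖ ^ 2 = Module.finrank ℝ (EuclideanSpace ℝ (Fin (d + 1))) := by
    simp [EuclideanSpace.real_norm_sq_eq, v, hdiag]
  have hsup (x) : ⨆ p : M, |∑ i, x i * e i p| = ‖U x‖ := by
    simp_rw [ContinuousMap.norm_eq_iSup_norm, hU, norm_eq_abs]
  simp_rw [hsup]
  set T : EuclideanSpace ℝ (Fin (d + 1)) → ℝ := fun x ↦ max (‖U x‖ - 1) 0
  have hTc : Continuous T := by fun_prop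
  have hTi : Integrable T σ := hTc.integrable_of_ae_norm_eq hσ1
  have hTai : Integrable (fun x ↦ T x ^ a) σ :=
    (hTc.rpow_const fun _ ↦ .inr ha0).integrable_of_ae_norm_eq hσ1
  have hT0 (x) : 0 ≤ T x := le_max_right _ _
  set c := b * (1 / κ) ^ m
  have hc0 : 0 < c := by positivity
  have hcball (p : M) : c ≤ μ.real (Metric.ball p (1 / κ)) :=
    (ENNReal.ofReal_le_iff_le_toReal (measure_ne_top _ _)).1
      (hball p _ (by positivity) hκr).le
  have hcheb : ∀ᵐ x ∂σ, c * T x ^ a ≤ ∫ p, |U x p| ^ a ∂μ := by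
    filter_upwards [hσ1] with x hx
    refine (U x).mul_rpow_norm_sub_one_le_integral hκpos ha0 hcball fun p q ↦ ?_
    rw [hU, hU]
    exact hLip x (by simpa using hx) p q
  have hvc : Continuous v := by fun_prop
  have hprod : Integrable (fun q : EuclideanSpace ℝ (Fin (d + 1)) × M ↦ |U q.1 q.2| ^ a)
      (σ.prod μ) := by
    simp_rw [hUv]
    have hcont' : Continuous fun q : EuclideanSpace ℝ (Fin (d + 1)) × M ↦
        |inner ℝ q.1 (v q.2)| ^ a :=
      (by fun_prop : Continuous fun q : EuclideanSpace ℝ (Fin (d + 1)) × M ↦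
        |inner ℝ q.1 (v q.2)|).rpow_const fun _ ↦ .inr ha0
    refine .of_bound hcont'.aestronglyMeasurable (√(d + 1) ^ a) ?_
    filter_upwards [Measure.quasiMeasurePreserving_fst.ae hσ1] with q hq
    rw [norm_of_nonneg (by positivity)]
    gcongr
    refine (abs_real_inner_le_norm _ _).trans (le_sqrt_of_sq_le ?_)
    simp [hq, hv]
  have hmain : c * (∫ x, T x ∂σ) ^ a < c * (K * S) ^ a := by
    calc c * (∫ x, T x ∂σ) ^ a ≤ c * ∫ x, T x ^ a ∂σ := by
          gcongr
          exact rpow_integral_le_integral_rpow (by linarith) hT0 hTi hTai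
      _ = ∫ x, c * T x ^ a ∂σ := (integral_const_mul _ _).symm
      _ ≤ ∫ x, ∫ p, |U x p| ^ a ∂μ ∂σ :=
          integral_mono_ae (hTai.const_mul c) hprod.integral_prod_left hcheb
      _ = ∫ p, ∫ x, |U x p| ^ a ∂σ ∂μ := integral_integral_swap hprod
      _ ≤ ∫ p, ∫ t, |t| ^ a ∂(ProbabilityTheory.gaussianReal 0 1) ∂μ := by
          refine integral_mono hprod.integral_prod_right (integrable_const _) fun p ↦ ?_
          simp_rw [hUv]
          exact integral_abs_inner_rpow_le_gaussianReal hσinv hσ1 hκlog (by simp) (hv p)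
      _ = 2 ^ (a / 2) * Gamma ((a + 1) / 2) / √π := by
          simp [ProbabilityTheory.integral_abs_rpow_gaussianReal ha0]
      _ < ((a + 1) / exp 1) ^ (a / 2) := Gamma_lt_rpow hκlog
      _ = 1 * S ^ a := by
          rw [hS, sqrt_eq_rpow, ← rpow_mul (by positivity), one_mul]
          congr 1
          ring
      _ ≤ c * K ^ a * S ^ a := by
          gcongr
          exact one_le_mul_max_rpow hb hκpos hκlog
      _ = c * (K * S) ^ a := by
          rw [mul_rpow (x := K) (y := S) (by positivity) (sqrt_nonneg _), mul_assoc]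
  have hlt : ∫ x, T x ∂σ < K * S :=
    (rpow_lt_rpow_iff (integral_nonneg hT0) (by positivity) (by linarith)).1
      (lt_of_mul_lt_mul_left hmain hc0.le)
  calc ∫ x, ‖U x‖ ∂σ ≤ ∫ x, (T x + 1) ∂σ :=
        integral_mono (hUc.norm.integrable_of_ae_norm_eq hσ1) (hTi.add (integrable_const 1))
          fun x ↦ by linarith [le_max_left (‖U x‖ - 1) 0]
    _ = ∫ x, T x ∂σ + 1 := by
        rw [integral_add hTi (integrable_const 1)]
        simp
    _ < K * S + 1 := by linarith
end

section
/- For every real t > 1/2, √(2/e) < (e/t)^{t−1/2} Γ(t)/√π < 1. -/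
open Real Filter Topology

/-- The logarithm of `(e / t) ^ (t - 1 / 2) * Γ(t)`. -/
noncomputable def logGammaRatio (t : ℝ) : ℝ :=
  Real.log (Real.Gamma t) - (t - 1 / 2) * Real.log t + (t - 1 / 2)

lemma exp_logGammaRatio {t : ℝ} (ht : 0 < t) :
    Real.exp (logGammaRatio t) = (Real.exp 1 / t) ^ (t - 1 / 2) * Real.Gamma t := by
  have hG := Real.Gamma_pos_of_pos ht
  have he := Real.exp_pos 1
  rw [Real.rpow_def_of_pos (div_pos he ht), Real.log_div he.ne' ht.ne', Real.log_exp]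
  rw [show logGammaRatio t = (1 - Real.log t) * (t - 1 / 2) + Real.log (Real.Gamma t) by
    rw [logGammaRatio]; ring, Real.exp_add, Real.exp_log hG]

lemma logGammaRatio_sub_add_one {t : ℝ} (ht : 0 < t) :
    logGammaRatio t - logGammaRatio (t + 1) = (t + 1 / 2) * Real.log (1 + t⁻¹) - 1 := by
  have h : 1 + t⁻¹ = (t + 1) / t := by field_simp
  rw [h, Real.log_div (by positivity) ht.ne', logGammaRatio, logGammaRatio,
    Real.Gamma_add_one ht.ne', Real.log_mul ht.ne' (Real.Gamma_pos_of_pos ht).ne']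
  ring

lemma hasSum_add_half_mul_log_one_add_inv {t : ℝ} (ht : 0 < t) :
    HasSum (fun k : ℕ => 1 / (2 * (k : ℝ) + 1) * (1 / (2 * t + 1)) ^ (2 * k))
      ((t + 1 / 2) * Real.log (1 + t⁻¹)) := by
  convert! (Real.hasSum_log_one_add_inv ht).mul_left (t + 1 / 2) using 1
  ext k
  rw [pow_succ]
  field_simp

lemma one_lt_add_half_mul_log_one_add_inv {t : ℝ} (ht : 0 < t) :
    1 < (t + 1 / 2) * Real.log (1 + t⁻¹) := by
  refine hasSum_lt (i := 1) (fun k => ?_) ?_ (hasSum_ite_eq (0 : ℕ) (1 : ℝ))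
    (hasSum_add_half_mul_log_one_add_inv ht)
  · split_ifs with hk
    · simp [hk]
    · positivity
  · rw [if_neg one_ne_zero]
    positivity

lemma strictAntiOn_add_half_mul_log_one_add_inv :
    StrictAntiOn (fun t : ℝ => (t + 1 / 2) * Real.log (1 + t⁻¹)) (Set.Ioi 0) := by
  intro s (hs : 0 < s) t (ht : 0 < t) hst
  have h : 1 / (2 * t + 1) < 1 / (2 * s + 1) :=
    one_div_lt_one_div_of_lt (by positivity) (by linarith)
  refine hasSum_lt (i := 1) (fun k => ?_) ?_ (hasSum_add_half_mul_log_one_add_inv ht)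
    (hasSum_add_half_mul_log_one_add_inv hs)
  · dsimp only
    gcongr
  · gcongr

lemma log_Gamma_add_nat {x : ℝ} (hx : 0 < x) (n : ℕ) :
    Real.log (Real.Gamma (x + n)) =
      Real.log (Real.Gamma x) + ∑ m ∈ Finset.range n, Real.log (x + m) := by
  refine Real.BohrMollerup.f_add_nat_eq (f := Real.log ∘ Real.Gamma) (fun {y} hy => ?_) hx n
  rw [Function.comp_apply, Function.comp_apply, Real.Gamma_add_one hy.ne',
    Real.log_mul hy.ne' (Real.Gamma_pos_of_pos hy).ne', add_comm]

lemma logGammaRatio_add_nat_add_one {x : ℝ} (hx : 0 < x) {n : ℕ} (hn : n ≠ 0) :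
    logGammaRatio (x + (n + 1 : ℕ)) =
      Real.log (Real.Gamma x) - Real.BohrMollerup.logGammaSeq x n
        + Real.log (Stirling.stirlingSeq n) + Real.log 2 / 2
        - (n * Real.log (1 + (x + 1) / n) + (x + 1 / 2) * Real.log (1 + (x + 1) / n))
        + (x + 1 / 2) := by
  have hn' : (0 : ℝ) < n := by positivity
  have h : 1 + (x + 1) / n = (x + (n + 1)) / n := by field_simp; ring
  rw [h, Real.log_div (by positivity) hn'.ne', logGammaRatio, log_Gamma_add_nat hx,
    Real.BohrMollerup.logGammaSeq, Stirling.log_stirlingSeq_formula,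
    Real.log_mul two_ne_zero hn'.ne', Real.log_div hn'.ne' (Real.exp_pos 1).ne', Real.log_exp]
  push_cast
  ring

lemma tendsto_logGammaRatio_add_nat {x : ℝ} (hx : 0 < x) :
    Tendsto (fun n : ℕ => logGammaRatio (x + n)) atTop
      (𝓝 (Real.log √Real.pi + Real.log 2 / 2 - 1 / 2)) := by
  rw [← tendsto_add_atTop_iff_nat 1]
  have hS := Stirling.tendsto_stirlingSeq_sqrt_pi.log (by positivity)
  have hG := (Real.BohrMollerup.tendsto_log_gamma hx).const_sub (Real.log (Real.Gamma x))
  have hM := (Real.tendsto_mul_log_one_add_div_atTop (x + 1)).comp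
    (tendsto_natCast_atTop_atTop (R := ℝ))
  have hL : Tendsto (fun n : ℕ => (x + 1 / 2) * Real.log (1 + (x + 1) / n)) atTop (𝓝 0) := by
    have := ((tendsto_const_div_atTop_nhds_zero_nat (x + 1)).const_add 1).log (by norm_num)
    simpa using this.const_mul (x + 1 / 2)
  have h := (((hG.add hS).add_const (Real.log 2 / 2)).sub (hM.add hL)).add_const (x + 1 / 2)
  have hlim : Real.log (Real.Gamma x) - Real.log (Real.Gamma x) + Real.log √Real.pi
      + Real.log 2 / 2 - (x + 1 + 0) + (x + 1 / 2)
      = Real.log √Real.pi + Real.log 2 / 2 - 1 / 2 := by ring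
  rw [hlim] at h
  refine h.congr' ?_
  filter_upwards [eventually_ne_atTop 0] with n hn
  exact (logGammaRatio_add_nat_add_one hx hn).symm

lemma logGammaRatio_add_one_lt {t : ℝ} (ht : 0 < t) :
    logGammaRatio (t + 1) < logGammaRatio t := by
  have h₁ := logGammaRatio_sub_add_one ht
  have h₂ := one_lt_add_half_mul_log_one_add_inv ht
  linarith

lemma logGammaRatio_sub_add_one_lt {s t : ℝ} (hs : 0 < s) (hst : s < t) :
    logGammaRatio (s + 1) - logGammaRatio (t + 1) < logGammaRatio s - logGammaRatio t := by
  have ht := hs.trans hst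
  have h₁ := logGammaRatio_sub_add_one hs
  have h₂ := logGammaRatio_sub_add_one ht
  have h₃ := strictAntiOn_add_half_mul_log_one_add_inv hs ht hst
  dsimp only at h₃
  linarith

lemma lt_logGammaRatio {t : ℝ} (ht : 0 < t) :
    Real.log √Real.pi + Real.log 2 / 2 - 1 / 2 < logGammaRatio t := by
  have hanti : Antitone fun n : ℕ => logGammaRatio (t + n) := antitone_nat_of_succ_le fun n => by
    have := logGammaRatio_add_one_lt (t := t + n) (by positivity)
    rw [add_assoc] at this
    exact_mod_cast this.le
  have h₁ := hanti.le_of_tendsto (tendsto_logGammaRatio_add_nat ht) 1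
  rw [Nat.cast_one] at h₁
  exact h₁.trans_lt (logGammaRatio_add_one_lt ht)

lemma strictAntiOn_logGammaRatio : StrictAntiOn logGammaRatio (Set.Ioi 0) := by
  intro s (hs : 0 < s) t (ht : 0 < t) hst
  have hanti : Antitone fun n : ℕ => logGammaRatio (s + n) - logGammaRatio (t + n) :=
    antitone_nat_of_succ_le fun n => by
      have := logGammaRatio_sub_add_one_lt (s := s + n) (t := t + n) (by positivity) (by linarith)
      rw [add_assoc, add_assoc] at this
      exact_mod_cast this.le
  have hlim := (tendsto_logGammaRatio_add_nat hs).sub (tendsto_logGammaRatio_add_nat ht)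
  rw [sub_self] at hlim
  have h₁ := hanti.le_of_tendsto hlim 1
  rw [Nat.cast_one] at h₁
  exact sub_pos.mp (h₁.trans_lt (logGammaRatio_sub_add_one_lt hs hst))

lemma logGammaRatio_one_half : logGammaRatio (1 / 2) = Real.log √Real.pi := by
  rw [logGammaRatio, Real.Gamma_one_half_eq]
  ring

theorem stmt_12 (t : ℝ) (ht : 1 / 2 < t) :
    Real.sqrt (2 / Real.exp 1)
        < (Real.exp 1 / t) ^ (t - 1 / 2) * Real.Gamma t / Real.sqrt Real.pi ∧
      (Real.exp 1 / t) ^ (t - 1 / 2) * Real.Gamma t / Real.sqrt Real.pi < 1 := by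
  have ht₀ : 0 < t := by linarith
  have hpi : 0 < √Real.pi := Real.sqrt_pos.mpr Real.pi_pos
  rw [← exp_logGammaRatio ht₀, lt_div_iff₀ hpi, div_lt_one hpi]
  constructor
  · rw [← Real.log_lt_iff_lt_exp (by positivity), Real.log_mul (by positivity) hpi.ne',
      Real.log_sqrt (by positivity), Real.log_div two_ne_zero (Real.exp_pos 1).ne', Real.log_exp]
    linarith [lt_logGammaRatio ht₀]
  · rw [← Real.lt_log_iff_exp_lt hpi, ← logGammaRatio_one_half]
    exact strictAntiOn_logGammaRatio (Set.mem_Ioi.mpr (by norm_num)) ht₀ ht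
end
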